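/- arXiv:1407.0675 — 3 statements merged into one kernel-verified Lean document; each statement's English description precedes it below -/
import Mathlib

section
/- For every u ∈ l²(ℤ) the second-order discrete interpolation inequality u(0)² ≤ (√2/2)·‖u‖^{3/2}·‖Δu‖^{1/2} holds, where Δu(n) := u(n+1) − 2u(n) + u(n−1). The constant √2/2 is sharp: it is the least constant C such that u(0)² ≤ C·‖u‖^{3/2}·‖Δu‖^{1/2} for all u ∈ l²(ℤ). -/
open Real

lemma hasSum_pow_natAbs {r : ℝ} (h0 : 0 ≤ r) (h1 : r < 1) :
    HasSum (fun n : ℤ => r ^ n.natAbs) ((1 + r) / (1 - r)) := by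
  have h := hasSum_geometric_of_lt_one h0 h1
  have key : HasSum (fun n : ℤ => r ^ n.natAbs) ((1 - r)⁻¹ + r * (1 - r)⁻¹) := by
    refine HasSum.of_nat_of_neg_add_one ?_ ?_
    · simpa using h
    · refine (h.mul_left r).congr_fun fun n => ?_
      rw [show (-((n : ℤ) + 1)).natAbs = n + 1 by omega, pow_succ']
  convert key using 1
  have : 1 - r ≠ 0 := by linarith
  field_simp

lemma laplacian_pow_natAbs {q c s : ℂ} (hq : q ^ 2 + 1 = (2 + c) * q) (hs : 2 * q - 2 = c + s)
    (n : ℤ) :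
    q ^ (n + 1).natAbs - 2 * q ^ n.natAbs + q ^ (n - 1).natAbs =
      c * q ^ n.natAbs + if n = 0 then s else 0 := by
  rcases lt_trichotomy n 0 with h | rfl | h
  · obtain ⟨k, rfl⟩ : ∃ k : ℕ, n = -((k : ℤ) + 1) := ⟨(-n - 1).toNat, by omega⟩
    rw [if_neg h.ne, show (-((k : ℤ) + 1) + 1).natAbs = k by omega,
      show (-((k : ℤ) + 1)).natAbs = k + 1 by omega,
      show (-((k : ℤ) + 1) - 1).natAbs = k + 2 by omega]
    linear_combination q ^ k * hq
  · simp
    linear_combination hs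
  · obtain ⟨k, rfl⟩ : ∃ k : ℕ, n = (k : ℤ) + 1 := ⟨(n - 1).toNat, by omega⟩
    rw [if_neg h.ne', show ((k : ℤ) + 1 + 1).natAbs = k + 2 by omega,
      show ((k : ℤ) + 1).natAbs = k + 1 by omega,
      show ((k : ℤ) + 1 - 1).natAbs = k by omega]
    linear_combination q ^ k * hq

lemma summable_mul_of_summable_sq {ι : Type*} {f g : ι → ℝ} (hf : Summable fun i => f i ^ 2)
    (hg : Summable fun i => g i ^ 2) : Summable fun i => f i * g i := by
  refine Summable.of_norm_bounded (hf.add hg) fun i => ?_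
  rw [Real.norm_eq_abs, abs_le]
  constructor <;> nlinarith [sq_nonneg (f i + g i), sq_nonneg (f i - g i)]

lemma sq_tsum_mul_le {ι : Type*} {f g : ι → ℝ} (hf : Summable fun i => f i ^ 2)
    (hg : Summable fun i => g i ^ 2) :
    (∑' i, f i * g i) ^ 2 ≤ (∑' i, f i ^ 2) * ∑' i, g i ^ 2 :=
  le_of_tendsto_of_tendsto' ((summable_mul_of_summable_sq hf hg).hasSum.pow 2)
    (Filter.Tendsto.mul hf.hasSum hg.hasSum) fun s => Finset.sum_mul_sq_le_sq_mul_sq s f g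

lemma summable_laplacian_sq {u : ℤ → ℝ} (hu : Summable fun n => u n ^ 2) :
    Summable fun n => (u (n + 1) - 2 * u n + u (n - 1)) ^ 2 := by
  have h1 : Summable fun n => u (n + 1) ^ 2 :=
    (Equiv.addRight (1 : ℤ)).summable_iff (f := fun n => u n ^ 2) |>.mpr hu
  have h2 : Summable fun n => u (n - 1) ^ 2 :=
    (Equiv.subRight (1 : ℤ)).summable_iff (f := fun n => u n ^ 2) |>.mpr hu
  refine Summable.of_nonneg_of_le (fun n => sq_nonneg _) (fun n => ?_)
    (((h1.add hu).add h2).mul_left 6)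
  nlinarith [sq_nonneg (2 * u (n + 1) + u n), sq_nonneg (u (n + 1) - u (n - 1)),
    sq_nonneg (2 * u (n - 1) + u n)]

/-- `q ^ |n|` is a multiple of the Green function of the operator `Δ - c`. -/
lemma hasSum_pow_natAbs_mul_laplacian {q c s : ℂ} (hq1 : ‖q‖ < 1)
    (hq : q ^ 2 + 1 = (2 + c) * q) (hs : 2 * q - 2 = c + s)
    {u : ℤ → ℝ} (hu : Summable fun n => u n ^ 2) :
    HasSum (fun n : ℤ => q ^ n.natAbs *
      (((u (n + 1) - 2 * u n + u (n - 1) : ℝ) : ℂ) - c * u n)) (s * u 0) := by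
  have hg : Summable fun n : ℤ => (‖q‖ ^ n.natAbs) ^ 2 := by
    convert (hasSum_pow_natAbs (sq_nonneg ‖q‖) (by nlinarith [norm_nonneg q])).summable using 1
    ext n
    rw [← pow_mul, ← pow_mul, mul_comm]
  have hsum (e : ℤ ≃ ℤ) : Summable fun n : ℤ => q ^ n.natAbs * (u (e n) : ℂ) := by
    refine Summable.of_norm ?_
    have h := (summable_mul_of_summable_sq hg ((e.summable_iff).mpr hu)).norm
    simpa using h
  have h0 := (hsum (Equiv.refl ℤ)).hasSum
  have h1 := (hsum (Equiv.addRight 1)).hasSum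
  have h2 := (hsum (Equiv.subRight 1)).hasSum
  have h1' := (Equiv.subRight (1 : ℤ)).hasSum_iff.mpr h1
  have h2' := (Equiv.addRight (1 : ℤ)).hasSum_iff.mpr h2
  have hT := (h1.sub (h0.mul_left (2 + c))).add h2
  have hT' := (h1'.sub (h0.mul_left (2 + c))).add h2'
  have hδ : HasSum (fun n : ℤ => if n = 0 then s * (u 0 : ℂ) else 0) (s * u 0) :=
    hasSum_ite_eq 0 _
  have heq := hT'.unique (hδ.congr_fun ?_)
  · rw [heq] at hT
    refine hT.congr_fun ?_
    intro n
    simp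
    ring
  · intro n
    have h := laplacian_pow_natAbs hq hs n
    by_cases hn : n = 0
    · subst hn
      simp at h ⊢
      linear_combination (u 0 : ℂ) * h
    · simp [hn] at h ⊢
      linear_combination (u n : ℂ) * h

/-- The root of `q + q⁻¹ = 2 + i (B² / A)` in the unit disc, when `A² = B² + 4`. -/
noncomputable def decayRate (A B : ℝ) : ℂ := ⟨(A - B) / A, -((A - B) * B / (2 * A))⟩

section decayRate

variable {A B : ℝ}

lemma decayRate_sq_add_one (hA : 0 < A) (h : A ^ 2 = B ^ 2 + 4) :
    decayRate A B ^ 2 + 1 = (2 + (⟨0, B ^ 2 / A⟩ : ℂ)) * decayRate A B := by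
  apply Complex.ext <;> simp [decayRate, pow_two] <;> field_simp
  · linear_combination (-B ^ 2) * h
  · ring

lemma two_mul_decayRate_sub_two (hA : 0 < A) :
    2 * decayRate A B - 2 = (⟨0, B ^ 2 / A⟩ : ℂ) + ⟨-(2 * B / A), -B⟩ := by
  apply Complex.ext <;> simp [decayRate] <;> field_simp <;> ring

lemma norm_decayRate_sq (hA : 0 < A) (h : A ^ 2 = B ^ 2 + 4) :
    ‖decayRate A B‖ ^ 2 = ((A - B) / 2) ^ 2 := by
  rw [← Complex.normSq_eq_norm_sq, Complex.normSq_apply, decayRate]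
  field_simp
  linear_combination (-(A - B) ^ 2) * h

lemma norm_decayRate_lt_one (hA : 0 < A) (hB : 0 < B) (h : A ^ 2 = B ^ 2 + 4) :
    ‖decayRate A B‖ < 1 := by
  have hA2 : 2 < A := by nlinarith
  have hAB : B < A := by nlinarith
  have h1 : (A - B) / 2 < 1 := by nlinarith
  rw [← sq_lt_one_iff₀ (norm_nonneg _), norm_decayRate_sq hA h]
  nlinarith

lemma hasSum_norm_decayRate_pow_sq (hA : 0 < A) (hB : 0 < B) (h : A ^ 2 = B ^ 2 + 4) :
    HasSum (fun n : ℤ => ‖decayRate A B ^ n.natAbs‖ ^ 2) (A / B) := by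
  have h1 := norm_decayRate_lt_one hA hB h
  have h2 : ‖decayRate A B‖ ^ 2 < 1 := by nlinarith [norm_nonneg (decayRate A B)]
  have := hasSum_pow_natAbs (sq_nonneg _) h2
  convert this using 1
  · ext n
    rw [norm_pow, ← pow_mul, ← pow_mul, mul_comm]
  · have h3 : 1 - ‖decayRate A B‖ ^ 2 ≠ 0 := by linarith
    rw [div_eq_div_iff hB.ne' h3, norm_decayRate_sq hA h]
    linear_combination ((B - A) / 4) * h

end decayRate

lemma sq_apply_zero_le {A B : ℝ} (hA : 0 < A) (hB : 0 < B) (h : A ^ 2 = B ^ 2 + 4)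
    {u : ℤ → ℝ} (hu : Summable fun n => u n ^ 2) :
    u 0 ^ 2 ≤ A ^ 3 / (B ^ 3 * (A ^ 2 + 4)) * ((B ^ 2 / A) ^ 2 * (∑' n, u n ^ 2) +
      ∑' n, (u (n + 1) - 2 * u n + u (n - 1)) ^ 2) := by
  set q := decayRate A B
  have hR := hasSum_pow_natAbs_mul_laplacian (norm_decayRate_lt_one hA hB h)
    (decayRate_sq_add_one hA h) (two_mul_decayRate_sub_two hA) hu
  have hg := hasSum_norm_decayRate_pow_sq hA hB h
  set w : ℤ → ℂ := fun n => ((u (n + 1) - 2 * u n + u (n - 1) : ℝ) : ℂ) - ⟨0, B ^ 2 / A⟩ * u n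
  have hw (n : ℤ) : ‖w n‖ ^ 2 =
      (B ^ 2 / A) ^ 2 * u n ^ 2 + (u (n + 1) - 2 * u n + u (n - 1)) ^ 2 := by
    rw [← Complex.normSq_eq_norm_sq, Complex.normSq_apply]
    simp [w]
    ring
  have hW : HasSum (fun n => ‖w n‖ ^ 2) ((B ^ 2 / A) ^ 2 * (∑' n, u n ^ 2) +
      ∑' n, (u (n + 1) - 2 * u n + u (n - 1)) ^ 2) := by
    simp only [hw]
    exact (hu.hasSum.mul_left _).add (summable_laplacian_sq hu).hasSum
  have hle : ‖(⟨-(2 * B / A), -B⟩ : ℂ) * u 0‖ ≤ ∑' n : ℤ, ‖q ^ n.natAbs‖ * ‖w n‖ := by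
    rw [← hR.tsum_eq]
    simp only [← norm_mul]
    refine norm_tsum_le_tsum_norm ?_
    simpa only [← norm_mul] using summable_mul_of_summable_sq hg.summable hW.summable
  have hsq := (pow_le_pow_left₀ (norm_nonneg _) hle 2).trans
    (sq_tsum_mul_le hg.summable hW.summable)
  rw [hg.tsum_eq, hW.tsum_eq, norm_mul, mul_pow, ← Complex.normSq_eq_norm_sq,
    Complex.normSq_apply, Complex.norm_real, Real.norm_eq_abs, sq_abs] at hsq
  set S := (B ^ 2 / A) ^ 2 * (∑' n, u n ^ 2) +
      ∑' n, (u (n + 1) - 2 * u n + u (n - 1)) ^ 2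
  have hpos : 0 < B ^ 2 * (A ^ 2 + 4) / A ^ 2 := by positivity
  refine le_of_mul_le_mul_left ?_ hpos
  calc _ = (-(2 * B / A) * -(2 * B / A) + -B * -B) * u 0 ^ 2 := by field_simp; ring
    _ ≤ A / B * S := hsq
    _ = _ := by field_simp

lemma cube_le_mul_sq_add_four_sq (A : ℝ) :
    A ^ 3 ≤ 3 * √3 / 32 * (A ^ 2 + 4) ^ 2 := by
  have h3 : √3 ^ 2 = 3 := Real.sq_sqrt (by norm_num)
  have h0 : 0 ≤ √3 * (A - 2 * √3) ^ 2 * (9 * A ^ 2 + 4 * √3 * A + 12) := by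
    have : 0 ≤ 9 * A ^ 2 + 4 * √3 * A + 12 := by nlinarith [sq_nonneg (2 * A + √3)]
    positivity
  have : √3 * (A - 2 * √3) ^ 2 * (9 * A ^ 2 + 4 * √3 * A + 12) =
      9 * √3 * (A ^ 2 + 4) ^ 2 - 96 * A ^ 3 := by
    have h4 : √3 ^ 4 = 9 := by rw [show (4 : ℕ) = 2 * 2 by norm_num, pow_mul, h3]; norm_num
    ring_nf
    simp only [h3, h4, show √3 ^ 3 = 3 * √3 by rw [pow_succ, h3]]
    ring
  linarith

lemma sq_apply_zero_le_of_pos {k : ℝ} (hk : 0 < k) {u : ℤ → ℝ}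
    (hu : Summable fun n => u n ^ 2) :
    u 0 ^ 2 ≤ √(3 * √3 / 32) * (k * (∑' n, u n ^ 2) +
      (∑' n, (u (n + 1) - 2 * u n + u (n - 1)) ^ 2) / k ^ 3) := by
  obtain ⟨A, hA, hAk⟩ : ∃ A : ℝ, 2 < A ∧ A ^ 2 - 4 = k ^ 2 * A := by
    have hs := Real.sq_sqrt (show 0 ≤ k ^ 4 + 16 by positivity)
    have hk4 : 4 < √(k ^ 4 + 16) := by
      rw [Real.lt_sqrt (by norm_num)]
      have := pow_pos hk 4
      linarith
    refine ⟨(k ^ 2 + √(k ^ 4 + 16)) / 2, by nlinarith [pow_pos hk 2], ?_⟩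
    linear_combination hs / 4
  have hA0 : 0 < A := by linarith
  have hkA : 0 < k ^ 2 * A := by positivity
  have hBsq := Real.sq_sqrt hkA.le
  have hB := Real.sqrt_pos.mpr hkA
  have hmain := sq_apply_zero_le hA0 hB (by rw [hBsq]; linarith) hu
  rw [hBsq, mul_div_cancel_right₀ _ hA0.ne'] at hmain
  set B := √(k ^ 2 * A)
  set a := ∑' n, u n ^ 2
  set b := ∑' n, (u (n + 1) - 2 * u n + u (n - 1)) ^ 2
  have ha : 0 ≤ a := tsum_nonneg fun n => sq_nonneg _
  have hb : 0 ≤ b := tsum_nonneg fun n => sq_nonneg _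
  have hG : k ^ 3 * (A ^ 3 / (B ^ 3 * (A ^ 2 + 4))) ≤ √(3 * √3 / 32) := by
    apply Real.le_sqrt_of_sq_le
    have hB6 : B ^ 6 = k ^ 6 * A ^ 3 := by
      rw [show (6 : ℕ) = 2 * 3 by norm_num, pow_mul, hBsq]; ring
    have : (k ^ 3 * (A ^ 3 / (B ^ 3 * (A ^ 2 + 4)))) ^ 2 = A ^ 3 / (A ^ 2 + 4) ^ 2 := by
      rw [mul_pow, div_pow, mul_pow, ← pow_mul B, hB6]
      field_simp
    rw [this, div_le_iff₀ (by positivity)]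
    exact cube_le_mul_sq_add_four_sq A
  calc _ ≤ _ := hmain
    _ = k ^ 3 * (A ^ 3 / (B ^ 3 * (A ^ 2 + 4))) * (k * a + b / k ^ 3) := by
      field_simp
    _ ≤ _ := by gcongr

lemma rpow_quarter_pow_four {x : ℝ} (hx : 0 ≤ x) : (x ^ (1 / 4 : ℝ)) ^ 4 = x := by
  rw [← Real.rpow_natCast, ← Real.rpow_mul hx]; norm_num

lemma rpow_quarter_pow_three {x : ℝ} (hx : 0 ≤ x) : (x ^ (1 / 4 : ℝ)) ^ 3 = x ^ (3 / 4 : ℝ) := by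
  rw [← Real.rpow_natCast, ← Real.rpow_mul hx]; norm_num

lemma le_of_forall_le_mul_add_div {a b v : ℝ} (ha : 0 ≤ a) (hb : 0 ≤ b) (hva : v ≤ a)
    (hv : ∀ k : ℝ, 0 < k → v ≤ √(3 * √3 / 32) * (k * a + b / k ^ 3)) :
    v ≤ √2 / 2 * a ^ (3 / 4 : ℝ) * b ^ (1 / 4 : ℝ) := by
  rcases ha.eq_or_lt with rfl | ha
  · simpa using hva
  rcases hb.eq_or_lt with rfl | hb
  · simp only [zero_div, add_zero] at hv
    rw [Real.zero_rpow (by norm_num), mul_zero]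
    refine le_of_forall_pos_le_add fun ε hε => ?_
    have hK : 0 < √(3 * √3 / 32) := by positivity
    have := hv (ε / (√(3 * √3 / 32) * a)) (by positivity)
    have e : √(3 * √3 / 32) * (ε / (√(3 * √3 / 32) * a) * a) = ε := by field_simp
    linarith
  · have hα := Real.rpow_pos_of_pos ha (1 / 4)
    have hβ := Real.rpow_pos_of_pos hb (1 / 4)
    have ha4 := rpow_quarter_pow_four ha.le
    have hb4 := rpow_quarter_pow_four hb.le
    rw [← rpow_quarter_pow_three ha.le]
    set α := a ^ (1 / 4 : ℝ)
    set β := b ^ (1 / 4 : ℝ)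
    have ht4 := rpow_quarter_pow_four (show (0 : ℝ) ≤ 3 by norm_num)
    have ht := Real.rpow_pos_of_pos (show (0 : ℝ) < 3 by norm_num) (1 / 4)
    set t : ℝ := 3 ^ (1 / 4 : ℝ)
    have hst : √3 = t ^ 2 := by
      rw [Real.sqrt_eq_iff_mul_self_eq (by norm_num) (by positivity)]
      linear_combination -ht4
    have hK : √(3 * √3 / 32) = √2 / 8 * t ^ 3 := by
      rw [Real.sqrt_eq_iff_mul_self_eq (by positivity) (by positivity), hst]
      have h2 := Real.sq_sqrt (show (0 : ℝ) ≤ 2 by norm_num)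
      linear_combination -(t ^ 6 / 64 * h2) - t ^ 2 / 32 * ht4
    have h := hv (t * β / α) (by positivity)
    refine h.trans_eq ?_
    rw [hK, ← ha4, ← hb4]
    field_simp
    linear_combination 2 * ht4

/-- The minimizer of `(16 / 3) ‖u‖² + ‖Δu‖²` among sequences with `u 0 = 1`. -/
lemma exists_extremal_sequence : ∃ u : ℤ → ℝ, Summable (fun n => u n ^ 2) ∧ u 0 = 1 ∧
    16 / 3 * (∑' n, u n ^ 2) + ∑' n, (u (n + 1) - 2 * u n + u (n - 1)) ^ 2 =
      64 / 9 * (√3 / √2) := by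
  have h3 : √3 ^ 2 = 3 := Real.sq_sqrt (by norm_num)
  have h2 : √2 ^ 2 = 2 := Real.sq_sqrt (by norm_num)
  have hA : 0 < 2 * √3 := by positivity
  have hB : 0 < 2 * √2 := by positivity
  have h : (2 * √3) ^ 2 = (2 * √2) ^ 2 + 4 := by rw [mul_pow, mul_pow, h3, h2]; norm_num
  set q := decayRate (2 * √3) (2 * √2)
  set m : ℝ := (2 * √2) ^ 2 / (2 * √3) with hm
  have hm2 : m ^ 2 = 16 / 3 := by
    rw [hm, div_pow, ← pow_mul, mul_pow, mul_pow, h3, pow_mul √2, h2]; norm_num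
  set z : ℂ := ⟨1, 1 / √3⟩
  have hz : ‖z‖ ^ 2 = 4 / 3 := by
    rw [← Complex.normSq_eq_norm_sq, Complex.normSq_apply]
    simp only [z]
    field_simp
    rw [h3]; norm_num
  set u : ℤ → ℝ := fun n => (z * q ^ n.natAbs).re with hu
  have hg := (hasSum_norm_decayRate_pow_sq hA hB h).mul_left (‖z‖ ^ 2)
  have hnorm (n : ℤ) : u n ^ 2 + (z * q ^ n.natAbs).im ^ 2 = ‖z‖ ^ 2 * ‖q ^ n.natAbs‖ ^ 2 := by
    rw [← mul_pow, ← norm_mul, ← Complex.normSq_eq_norm_sq, Complex.normSq_apply]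
    simp only [hu]
    ring
  have hus : Summable fun n => u n ^ 2 :=
    Summable.of_nonneg_of_le (fun n => sq_nonneg _)
      (fun n => by nlinarith [hnorm n, sq_nonneg (z * q ^ n.natAbs).im]) hg.summable
  have hΔ (n : ℤ) : u (n + 1) - 2 * u n + u (n - 1) = -m * (z * q ^ n.natAbs).im := by
    have e := congrArg (fun x => (z * x).re)
      (laplacian_pow_natAbs (decayRate_sq_add_one hA h) (two_mul_decayRate_sub_two hA) n)
    have hzs : (z * if n = 0 then (⟨-(2 * (2 * √2) / (2 * √3)), -(2 * √2)⟩ : ℂ) else 0).re = 0 := by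
      split_ifs
      · simp [z]
        field_simp
        ring
      · simp
    have e1 : (z * (⟨0, m⟩ * q ^ n.natAbs)).re = -m * (z * q ^ n.natAbs).im := by
      simp
      ring
    simp only [mul_add (a := z), Complex.add_re, hzs, add_zero] at e
    rw [← e1]
    refine Eq.trans ?_ e
    simp [hu]
    ring
  refine ⟨u, hus, by simp [hu, z], ?_⟩
  rw [← hm2]
  refine ((hus.hasSum.mul_left (m ^ 2)).add (summable_laplacian_sq hus).hasSum).unique ?_
  convert hg.mul_left (m ^ 2) using 1
  · ext n
    rw [hΔ, ← hnorm]
    ring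
  · rw [hm2, hz]
    field_simp
    norm_num

lemma rpow_mul_rpow_le_sqrt_two {a b : ℝ} (ha : 0 ≤ a) (hb : 0 ≤ b)
    (h : 16 / 3 * a + b = 64 / 9 * (√3 / √2)) :
    a ^ (3 / 4 : ℝ) * b ^ (1 / 4 : ℝ) ≤ √2 := by
  have hw := Real.geom_mean_le_arith_mean2_weighted (show (0 : ℝ) ≤ 3 / 4 by norm_num)
    (show (0 : ℝ) ≤ 1 / 4 by norm_num) (show 0 ≤ 16 / 9 * a by positivity) hb (by norm_num)
  have hc : (16 / 9 : ℝ) ^ (3 / 4 : ℝ) = 8 / 9 * √3 := by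
    have h3 : √3 ^ 2 = 3 := Real.sq_sqrt (by norm_num)
    have : (16 / 9 : ℝ) = (2 / √3) ^ (4 : ℝ) := by
      rw [show (4 : ℝ) = ((4 : ℕ) : ℝ) by norm_num, Real.rpow_natCast, div_pow,
        show √3 ^ 4 = (√3 ^ 2) ^ 2 by ring, h3]
      norm_num
    rw [this, ← Real.rpow_mul (by positivity), show (4 : ℝ) * (3 / 4) = ((3 : ℕ) : ℝ) by norm_num,
      Real.rpow_natCast, div_pow, pow_succ (√3) 2, h3]
    field_simp
    rw [h3]; norm_num
  rw [Real.mul_rpow (by norm_num) ha, hc, mul_assoc] at hw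
  have h2 : √2 ^ 2 = 2 := Real.sq_sqrt (by norm_num)
  have hs : √3 / √2 = √3 * √2 / 2 := by
    field_simp
    rw [h2]
  rw [hs] at h
  refine le_of_mul_le_mul_left ?_ (show 0 < 8 / 9 * √3 by positivity)
  linarith

/-- Second-order discrete interpolation inequality
`u(0)² ≤ (√2/2) ‖u‖^{3/2} ‖Δu‖^{1/2}` on `l²(ℤ)`, where
`Δu(n) = u(n+1) - 2u(n) + u(n-1)`, and `√2/2` is the least such constant. -/
theorem second_order_interpolation_1D :
    (∀ u : ℤ → ℝ, Summable (fun n => u n ^ 2) →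
      u 0 ^ 2 ≤ (Real.sqrt 2 / 2) * (∑' n : ℤ, u n ^ 2) ^ (3 / 4 : ℝ) *
        (∑' n : ℤ, (u (n + 1) - 2 * u n + u (n - 1)) ^ 2) ^ (1 / 4 : ℝ)) ∧
    (∀ C : ℝ,
      (∀ u : ℤ → ℝ, Summable (fun n => u n ^ 2) →
        u 0 ^ 2 ≤ C * (∑' n : ℤ, u n ^ 2) ^ (3 / 4 : ℝ) *
          (∑' n : ℤ, (u (n + 1) - 2 * u n + u (n - 1)) ^ 2) ^ (1 / 4 : ℝ)) →
      Real.sqrt 2 / 2 ≤ C) := by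
  refine ⟨fun u hu => ?_, fun C hC => ?_⟩
  · exact le_of_forall_le_mul_add_div (tsum_nonneg fun n => sq_nonneg _)
      (tsum_nonneg fun n => sq_nonneg _) (hu.le_tsum 0 fun n _ => sq_nonneg _)
      fun k hk => sq_apply_zero_le_of_pos hk hu
  · obtain ⟨u, hu, h0, hsum⟩ := exists_extremal_sequence
    have h := hC u hu
    have ha : 0 ≤ ∑' n, u n ^ 2 := tsum_nonneg fun n => sq_nonneg _
    have hb : 0 ≤ ∑' n, (u (n + 1) - 2 * u n + u (n - 1)) ^ 2 :=
      tsum_nonneg fun n => sq_nonneg _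
    have hle := rpow_mul_rpow_le_sqrt_two ha hb hsum
    rw [h0, one_pow, mul_assoc] at h
    set P := (∑' n : ℤ, u n ^ 2) ^ (3 / 4 : ℝ) *
      (∑' n : ℤ, (u (n + 1) - 2 * u n + u (n - 1)) ^ 2) ^ (1 / 4 : ℝ)
    have hP : 0 ≤ P := by positivity
    have hCpos : 0 < C := by
      by_contra! hC0
      nlinarith
    have h2 : √2 ^ 2 = 2 := Real.sq_sqrt (by norm_num)
    have : 1 ≤ C * √2 := h.trans (by gcongr)
    nlinarith [Real.sqrt_nonneg 2]
end

section
/- For λ > 0, (1/(2π))·∫_{−π}^{π} dx / (λ + 16 sin⁴(x/2)) = (√2/2)·λ^{−3/4}·√( (√(λ+16) + √λ) / (λ+16) ). -/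
open Real

theorem integral_mul_exp_div_one_sub_mul_exp {z : ℂ} (hz : ‖z‖ < 1) :
    ∫ x in (-π : ℝ)..π, z * Complex.exp (x * Complex.I) / (1 - z * Complex.exp (x * Complex.I))
      = 0 := by
  have hn (x : ℝ) : ‖z * Complex.exp (x * Complex.I)‖ < 1 := by
    rwa [norm_mul, Complex.norm_exp_ofReal_mul_I, mul_one]
  have hs (x : ℝ) : 1 - z * Complex.exp (x * Complex.I) ∈ Complex.slitPlane := by
    rw [sub_eq_add_neg]
    exact Complex.mem_slitPlane_of_norm_lt_one (by rw [norm_neg]; exact hn x)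
  have hd (x : ℝ) : HasDerivAt
      (fun x : ℝ ↦ Complex.I * Complex.log (1 - z * Complex.exp (x * Complex.I)))
      (z * Complex.exp (x * Complex.I) / (1 - z * Complex.exp (x * Complex.I))) x := by
    have h1 : HasDerivAt (fun x : ℝ ↦ 1 - z * Complex.exp (x * Complex.I))
        (-(z * (Complex.exp (x * Complex.I) * (1 * Complex.I)))) x :=
      ((((hasDerivAt_id x).ofReal_comp.mul_const Complex.I).cexp.const_mul z).const_sub 1)
    refine ((h1.clog_real (hs x)).const_mul Complex.I).congr_deriv ?_
    rw [mul_div_assoc']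
    congr 1
    linear_combination -(z * Complex.exp (x * Complex.I)) * Complex.I_sq
  rw [intervalIntegral.integral_eq_sub_of_hasDerivAt (fun x _ ↦ hd x)]
  · simp [Complex.exp_neg]
  · refine Continuous.intervalIntegrable ?_ _ _
    exact Continuous.div (by fun_prop) (by fun_prop) fun x ↦ Complex.slitPlane_ne_zero (hs x)

theorem integral_inv_add_inv_sub_two_mul_cos {z : ℂ} (hz : ‖z‖ < 1) (hz0 : z ≠ 0) :
    ∫ x in (-π : ℝ)..π, 1 / (z + z⁻¹ - 2 * Complex.cos x) = 2 * π * (z / (1 - z ^ 2)) := by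
  have hne {w : ℂ} (hw : ‖w‖ = 1) : 1 - z * w ≠ 0 := fun h ↦ by
    have := congrArg norm (sub_eq_zero.mp h)
    rw [norm_mul, hw, norm_one] at this
    linarith
  have h2 : 1 - z ^ 2 ≠ 0 := fun h ↦ by
    have := congrArg norm (sub_eq_zero.mp h)
    rw [norm_pow, norm_one] at this
    nlinarith [norm_nonneg z]
  set f : ℝ → ℂ := fun x ↦
    z * Complex.exp (x * Complex.I) / (1 - z * Complex.exp (x * Complex.I)) with hf
  have hfc : Continuous f :=
    Continuous.div (by fun_prop) (by fun_prop) fun x ↦ hne (Complex.norm_exp_ofReal_mul_I x)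
  have hpt (x : ℝ) : 1 / (z + z⁻¹ - 2 * Complex.cos x) =
      z / (1 - z ^ 2) * (1 + f x + f (-x)) := by
    set e := Complex.exp (x * Complex.I) with he
    have he0 : e ≠ 0 := Complex.exp_ne_zero _
    have hfx : f x = z * e / (1 - z * e) := rfl
    have hfx' : f (-x) = z * e⁻¹ / (1 - z * e⁻¹) := by
      simp only [hf, he, Complex.ofReal_neg, neg_mul, Complex.exp_neg]
    have hc : 2 * Complex.cos x = e + e⁻¹ := by
      rw [Complex.two_cos, he, ← Complex.exp_neg, neg_mul]
    have hp : 1 - z * e ≠ 0 := hne (Complex.norm_exp_ofReal_mul_I x)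
    have hm : 1 - z * e⁻¹ ≠ 0 := hne (by rw [norm_inv, Complex.norm_exp_ofReal_mul_I, inv_one])
    have hfac : z + z⁻¹ - 2 * Complex.cos x = z⁻¹ * ((1 - z * e) * (1 - z * e⁻¹)) := by
      rw [hc]; field_simp; ring
    have hnum : 1 + f x + f (-x) = (1 - z ^ 2) / ((1 - z * e) * (1 - z * e⁻¹)) := by
      rw [hfx, hfx', eq_div_iff (mul_ne_zero hp hm)]
      have : z * e * (z * e⁻¹) = z ^ 2 := by field_simp
      calc _ = (1 - z * e) * (1 - z * e⁻¹)
              + (z * e / (1 - z * e) * (1 - z * e)) * (1 - z * e⁻¹)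
              + (z * e⁻¹ / (1 - z * e⁻¹) * (1 - z * e⁻¹)) * (1 - z * e) := by ring
        _ = _ := by
          rw [div_mul_cancel₀ _ hp, div_mul_cancel₀ _ hm]
          linear_combination -this
    rw [hfac, hnum]
    generalize (1 - z * e) * (1 - z * e⁻¹) = d
    field_simp
  have hi : ∫ x in (-π : ℝ)..π, f x = 0 := integral_mul_exp_div_one_sub_mul_exp hz
  have hi' : ∫ x in (-π : ℝ)..π, f (-x) = 0 := by
    rw [intervalIntegral.integral_comp_neg, neg_neg, hi]
  simp_rw [hpt]
  rw [intervalIntegral.integral_const_mul, intervalIntegral.integral_add,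
    intervalIntegral.integral_add, hi, hi', intervalIntegral.integral_const]
  · simp; ring
  all_goals exact Continuous.intervalIntegrable (by fun_prop) _ _

theorem Complex.exists_norm_lt_one_add_inv_eq {a : ℂ} (ha : a.im ≠ 0) :
    ∃ z : ℂ, ‖z‖ < 1 ∧ z ≠ 0 ∧ z + z⁻¹ = a := by
  obtain ⟨s, hs⟩ := IsAlgClosed.exists_pow_nat_eq (a ^ 2 - 4) (n := 2) two_pos
  set z := (a + s) / 2 with hz
  have hmul : z * ((a - s) / 2) = 1 := by rw [hz]; linear_combination -hs / 4
  have hz0 : z ≠ 0 := left_ne_zero_of_mul_eq_one hmul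
  have hinv : z⁻¹ = (a - s) / 2 := inv_eq_of_mul_eq_one_right hmul
  have hsum : z + z⁻¹ = a := by rw [hinv, hz]; ring
  rcases lt_trichotomy ‖z‖ 1 with h | h | h
  · exact ⟨z, h, hz0, hsum⟩
  · refine absurd ?_ ha
    rw [← hsum, Complex.inv_eq_conj h]
    simp
  · exact ⟨z⁻¹, by rw [norm_inv]; exact inv_lt_one_of_one_lt₀ h, inv_ne_zero hz0, by
      rw [inv_inv, add_comm, hsum]⟩

/-- For `λ > 0`,
`(1/(2π)) ∫_{-π}^{π} dx/(λ + 16 sin⁴(x/2))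
  = (√2/2) λ^{-3/4} √((√(λ+16)+√λ)/(λ+16))`. -/
theorem green_function_biharmonic_at_origin (lam : ℝ) (hlam : 0 < lam) :
    (1 / (2 * π)) * (∫ x in (-π : ℝ)..π, 1 / (lam + 16 * Real.sin (x / 2) ^ 4)) =
      (Real.sqrt 2 / 2) * lam ^ (-(3 / 4) : ℝ) *
        Real.sqrt ((Real.sqrt (lam + 16) + Real.sqrt lam) / (lam + 16)) := by
  obtain ⟨c, hc, rfl⟩ : ∃ c : ℝ, 0 < c ∧ lam = c ^ 2 :=
    ⟨√lam, Real.sqrt_pos.mpr hlam, (Real.sq_sqrt hlam.le).symm⟩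
  obtain ⟨z, hz, hz0, hza⟩ :=
    Complex.exists_norm_lt_one_add_inv_eq (a := 2 - c * Complex.I) (by simpa using hc.ne')
  set w := z / (1 - z ^ 2) with hw
  have hpt (x : ℝ) : 1 / (c ^ 2 + 16 * Real.sin (x / 2) ^ 4) =
      c⁻¹ * Complex.imCLM (1 / (z + z⁻¹ - 2 * Complex.cos x)) := by
    have hs : 16 * Real.sin (x / 2) ^ 4 = (2 - 2 * Real.cos x) ^ 2 := by
      have : 2 * Real.sin (x / 2) ^ 2 = 1 - Real.cos x := by
        rw [Real.sin_sq_eq_half_sub, mul_div_cancel₀ x two_ne_zero]; ring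
      linear_combination 4 * (2 * Real.sin (x / 2) ^ 2 + (1 - Real.cos x)) * this
    have hcos : z + z⁻¹ - 2 * Complex.cos x =
        (⟨2 - 2 * Real.cos x, -c⟩ : ℂ) := by
      rw [hza]; apply Complex.ext <;> simp [← Complex.ofReal_cos]
    have : 0 < c ^ 2 + (2 - 2 * Real.cos x) ^ 2 := by positivity
    rw [hs, hcos, Complex.imCLM_apply, one_div (_ : ℂ), Complex.inv_im, Complex.normSq_mk, neg_neg]
    have h' : (2 - 2 * Real.cos x) * (2 - 2 * Real.cos x) + -c * -c =
      c ^ 2 + (2 - 2 * Real.cos x) ^ 2 := by ring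
    rw [h']
    field_simp
  have hcont : Continuous fun x : ℝ ↦ 1 / (z + z⁻¹ - 2 * Complex.cos x) := by
    refine Continuous.div (by fun_prop) (by fun_prop) fun x h ↦ hc.ne' ?_
    rw [hza] at h
    simpa [← Complex.ofReal_cos] using congrArg Complex.im h
  have hI : 1 / (2 * π) * (∫ x in (-π : ℝ)..π, 1 / (c ^ 2 + 16 * Real.sin (x / 2) ^ 4)) =
      w.im / c := by
    simp_rw [hpt]
    rw [intervalIntegral.integral_const_mul,
      Complex.imCLM.intervalIntegral_comp_comm (hcont.intervalIntegrable _ _),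
      integral_inv_add_inv_sub_two_mul_cos hz hz0, ← hw, Complex.imCLM_apply]
    have : (2 * π * w : ℂ).im = 2 * π * w.im := by
      rw [show (2 * π * w : ℂ) = ((2 * π : ℝ) : ℂ) * w by push_cast; ring, Complex.im_ofReal_mul]
    rw [this]
    field_simp
  have hnonneg : 0 ≤ w.im / c := by
    rw [← hI]
    refine mul_nonneg (by positivity) (intervalIntegral.integral_nonneg (by linarith [pi_pos]) ?_)
    intro x _
    positivity
  have hwsq : w ^ 2 * (-c ^ 2 - 4 * c * Complex.I) = 1 := by
    have h2 : 1 - z ^ 2 ≠ 0 := fun h ↦ by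
      have := congrArg norm (sub_eq_zero.mp h)
      rw [norm_pow, norm_one] at this
      nlinarith [norm_nonneg z]
    have : (-c ^ 2 - 4 * c * Complex.I : ℂ) = (z⁻¹ - z) ^ 2 := by
      have h4 : (z⁻¹ - z) ^ 2 = (z + z⁻¹) ^ 2 - 4 := by field_simp; ring
      rw [h4, hza]
      linear_combination -(c : ℂ) ^ 2 * Complex.I_sq
    rw [this, hw]
    field_simp
  set p := w.re
  set q := w.im
  have hre : (p ^ 2 - q ^ 2) * c ^ 2 - 8 * c * p * q = -1 := by
    have := congrArg Complex.re hwsq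
    simp [pow_two] at this
    linarith
  have him : (p ^ 2 - q ^ 2) * 4 * c + 2 * p * q * c ^ 2 = 0 := by
    have := congrArg Complex.im hwsq
    simp [pow_two] at this
    linarith
  set d := √(c ^ 2 + 16) with hd
  have hd2 : d ^ 2 = c ^ 2 + 16 := Real.sq_sqrt (by positivity)
  have hd0 : 0 < d := Real.sqrt_pos.mpr (by positivity)
  have hpq : c * (2 * p * q) = -4 * (p ^ 2 - q ^ 2) := by
    apply mul_left_cancel₀ hc.ne'; linarith
  have hdiff : (p ^ 2 - q ^ 2) * d ^ 2 = -1 := by rw [hd2]; linarith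
  have hsum : (p ^ 2 + q ^ 2) * (c * d) = 1 := by
    have : ((p ^ 2 + q ^ 2) * (c * d)) ^ 2 = 1 := by
      have h5 : ((p ^ 2 + q ^ 2) * c) ^ 2 = (p ^ 2 - q ^ 2) ^ 2 * d ^ 2 := by
        rw [hd2]
        linear_combination (c * (2 * p * q) - 4 * (p ^ 2 - q ^ 2)) * hpq
      calc _ = ((p ^ 2 + q ^ 2) * c) ^ 2 * d ^ 2 := by ring
        _ = ((p ^ 2 - q ^ 2) * d ^ 2) ^ 2 := by rw [h5]; ring
        _ = 1 := by rw [hdiff]; norm_num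
    exact (pow_eq_one_iff_of_nonneg (by positivity) two_ne_zero).mp this
  have hq : 2 * q ^ 2 * (c * d ^ 2) = d + c := by
    linear_combination d * hsum - c * hdiff
  rw [hI, Real.sqrt_sq hc.le, ← hd2]
  refine (sq_eq_sq₀ hnonneg (by positivity)).mp ?_
  have hpow : ((c ^ 2) ^ (-(3 / 4) : ℝ)) ^ 2 = (c ^ 3)⁻¹ := by
    rw [← Real.rpow_natCast (_ ^ _) 2, ← Real.rpow_mul (by positivity), ← Real.rpow_natCast c 2,
      ← Real.rpow_mul hc.le, ← Real.rpow_natCast c 3, ← Real.rpow_neg hc.le]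
    norm_num
  rw [mul_pow, mul_pow, hpow, Real.sq_sqrt (by positivity), div_pow, div_pow,
    Real.sq_sqrt two_pos.le, ← hq]
  field_simp
end

section
/- Let d ≥ 3 and let p be a real number with p > d/(d−2); set p' := p/(p−1) and I_{p',d} := ( ∫_{[0,2π]^d} dx / ( sin²(x₁/2) + ⋯ + sin²(x_d/2) )^{p'} )^{1/p'}, which is finite since p' < d/2. Then for every u ∈ l²(ℤ^d), ( ∑_{n∈ℤ^d} |u(n)|^{2p} )^{1/p} ≤ (1/4)·(2π)^{d(p+1)/p}·I_{p',d}·‖∇u‖². -/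
open Real

open MeasureTheory ENNReal

/-- Cauchy-Schwarz bound for the part of `F` living where the weight `W` is small. -/
theorem setLIntegral_sublevel_le {X : Type*} [MeasurableSpace X] {μ : Measure X}
    {F : X → ℝ≥0∞} {W : X → ℝ} {p E J t : ℝ} (hF : AEMeasurable F μ) (hW : Measurable W)
    (hW0 : ∀ᵐ x ∂μ, 0 < W x) (hp : 1 < p) (hE : 0 < E) (hJ : 0 < J) (ht : 0 < t)
    (hFE : ∫⁻ x, F x ^ 2 * ENNReal.ofReal (W x) ∂μ ≤ ENNReal.ofReal E)
    (hWJ : ∫⁻ x, ENNReal.ofReal (W x ^ (-(p / (p - 1)))) ∂μ ≤ ENNReal.ofReal J) :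
    ∫⁻ x in {x | √(4 * E * J) * W x ^ (1 / (2 * (p - 1))) < t}, F x ∂μ ≤
      ENNReal.ofReal (t / 2) := by
  have hp1 : 0 < p - 1 := by linarith
  set s := {x | √(4 * E * J) * W x ^ (1 / (2 * (p - 1))) < t} with hs
  have hsm : MeasurableSet s :=
    measurableSet_lt (measurable_const.mul (hW.pow_const _)) measurable_const
  have hinv : ∀ᵐ x ∂μ.restrict s, ENNReal.ofReal (W x)⁻¹ ≤
      ENNReal.ofReal (t ^ 2 / (4 * E * J)) * ENNReal.ofReal (W x ^ (-(p / (p - 1)))) := by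
    filter_upwards [ae_restrict_mem hsm, ae_restrict_of_ae hW0] with x hx hx0
    rw [← ENNReal.ofReal_mul (by positivity)]
    apply ENNReal.ofReal_le_ofReal
    have h1 : (W x)⁻¹ = (W x ^ (1 / (2 * (p - 1)))) ^ 2 * W x ^ (-(p / (p - 1))) := by
      rw [← Real.rpow_natCast, ← Real.rpow_mul hx0.le, ← Real.rpow_add hx0, ← Real.rpow_neg_one]
      congr 1
      push_cast
      field_simp
      ring
    rw [h1]
    gcongr
    rw [le_div_iff₀ (by positivity)]
    calc (W x ^ (1 / (2 * (p - 1)))) ^ 2 * (4 * E * J)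
        = (√(4 * E * J) * W x ^ (1 / (2 * (p - 1)))) ^ 2 := by
          rw [mul_pow, Real.sq_sqrt (by positivity)]; ring
      _ ≤ t ^ 2 := by
          have : √(4 * E * J) * W x ^ (1 / (2 * (p - 1))) < t := hx
          gcongr
  calc ∫⁻ x in s, F x ∂μ
      = ∫⁻ x in s, ((fun x => F x * ENNReal.ofReal (√(W x))) *
          fun x => ENNReal.ofReal (√((W x)⁻¹))) x ∂μ := by
        apply lintegral_congr_ae
        filter_upwards [ae_restrict_of_ae hW0] with x hx0
        rw [Pi.mul_apply, mul_assoc, ← ENNReal.ofReal_mul (by positivity),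
          ← Real.sqrt_mul hx0.le, mul_inv_cancel₀ hx0.ne']
        simp
    _ ≤ (∫⁻ x in s, (F x * ENNReal.ofReal (√(W x))) ^ (2 : ℝ) ∂μ) ^ (1 / (2 : ℝ)) *
          (∫⁻ x in s, (ENNReal.ofReal (√((W x)⁻¹))) ^ (2 : ℝ) ∂μ) ^ (1 / (2 : ℝ)) :=
        ENNReal.lintegral_mul_le_Lp_mul_Lq _ Real.HolderConjugate.two_two
          (hF.restrict.mul (by fun_prop)) (by fun_prop)
    _ ≤ (ENNReal.ofReal E) ^ (1 / (2 : ℝ)) *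
          (ENNReal.ofReal (t ^ 2 / (4 * E * J)) * ENNReal.ofReal J) ^ (1 / (2 : ℝ)) := by
        gcongr
        · refine le_trans (setLIntegral_le_lintegral _ _) (le_trans (lintegral_mono_ae ?_) hFE)
          filter_upwards [hW0] with x hx0
          rw [ENNReal.rpow_two, mul_pow, ← ENNReal.ofReal_pow (by positivity), Real.sq_sqrt hx0.le]
        · refine le_trans (lintegral_mono_ae (g := fun x => ENNReal.ofReal (t ^ 2 / (4 * E * J)) *
            ENNReal.ofReal (W x ^ (-(p / (p - 1))))) ?_) ?_
          · filter_upwards [hinv, ae_restrict_of_ae hW0] with x hx hx0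
            rwa [ENNReal.rpow_two, ← ENNReal.ofReal_pow (by positivity),
              Real.sq_sqrt (by positivity)]
          · rw [lintegral_const_mul _ (by fun_prop)]
            gcongr
            exact (setLIntegral_le_lintegral _ _).trans hWJ
    _ = ENNReal.ofReal (t / 2) := by
        rw [← ENNReal.mul_rpow_of_nonneg _ _ (by norm_num), ← ENNReal.ofReal_mul (by positivity),
          ← ENNReal.ofReal_mul (by positivity), ENNReal.ofReal_rpow_of_pos (by positivity),
          ← Real.sqrt_eq_rpow]
        congr 1
        rw [show E * (t ^ 2 / (4 * E * J) * J) = (t / 2) ^ 2 by field_simp; norm_num]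
        exact Real.sqrt_sq (by positivity)

theorem count_lt_le_of_split {X ι : Type*} [MeasurableSpace X] [MeasurableSpace ι] [Countable ι]
    [MeasurableSingletonClass ι] {μ : Measure X}
    {F : X → ℝ≥0∞} {W : X → ℝ} {u : ι → ℝ} {p E J t : ℝ} (hF : AEMeasurable F μ)
    (hW : Measurable W)
    (hsplit : ∀ s, MeasurableSet s → ∃ b : ι → ℝ≥0∞,
      (∀ n, ENNReal.ofReal |u n| ≤ ∫⁻ x in s, F x ∂μ + b n) ∧
        ∑' n, b n ^ 2 ≤ ∫⁻ x in sᶜ, F x ^ 2 ∂μ)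
    (hW0 : ∀ᵐ x ∂μ, 0 < W x) (hp : 1 < p) (hE : 0 < E) (hJ : 0 < J) (ht : 0 < t)
    (hFE : ∫⁻ x, F x ^ 2 * ENNReal.ofReal (W x) ∂μ ≤ ENNReal.ofReal E)
    (hWJ : ∫⁻ x, ENNReal.ofReal (W x ^ (-(p / (p - 1)))) ∂μ ≤ ENNReal.ofReal J) :
    Measure.count {n | t < |u n|} ≤ ENNReal.ofReal (4 / t ^ 2) *
      ∫⁻ x in {x | t ≤ √(4 * E * J) * W x ^ (1 / (2 * (p - 1)))}, F x ^ 2 ∂μ := by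
  have hlow := setLIntegral_sublevel_le hF hW hW0 hp hE hJ ht hFE hWJ
  set s := {x | √(4 * E * J) * W x ^ (1 / (2 * (p - 1))) < t} with hs
  have hsm : MeasurableSet s :=
    measurableSet_lt (measurable_const.mul (hW.pow_const _)) measurable_const
  have hsc : {x | t ≤ √(4 * E * J) * W x ^ (1 / (2 * (p - 1)))} = sᶜ := by
    ext x; simp [hs]
  rw [hsc]
  obtain ⟨b, hb, hb2⟩ := hsplit s hsm
  have hsub : {n | t < |u n|} ⊆ {n | ENNReal.ofReal (t ^ 2 / 4) ≤ b n ^ 2} := by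
    intro n hn
    have h1 : ENNReal.ofReal (t / 2) + ENNReal.ofReal (t / 2) ≤
        ENNReal.ofReal (t / 2) + b n := by
      rw [← ENNReal.ofReal_add (by positivity) (by positivity), add_halves]
      exact (ENNReal.ofReal_le_ofReal (le_of_lt hn)).trans ((hb n).trans (by gcongr))
    have h2 := (ENNReal.add_le_add_iff_left ENNReal.ofReal_ne_top).1 h1
    rw [Set.mem_ofPred_eq, show t ^ 2 / 4 = (t / 2) ^ 2 by ring, ENNReal.ofReal_pow (by positivity)]
    gcongr
  refine (measure_mono hsub).trans ((ENNReal.count_const_le_le_of_tsum_le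
    (measurable_of_countable _) hb2
    (ENNReal.ofReal_pos.2 (by positivity)).ne' ENNReal.ofReal_ne_top).trans ?_)
  rw [ENNReal.div_eq_inv_mul, ← ENNReal.ofReal_inv_of_pos (by positivity), inv_div]

/-- A real-interpolation bound: if `u` splits, along every measurable set `s`, into a part bounded
by `∫ F` over `s` and a part whose `ℓ²` norm is controlled by that of `F` off `s`, then
`∑ |u n| ^ (2 * p)` is controlled by `∫ F ^ 2 * W` and `∫ W ^ (-(p / (p - 1)))`. -/
theorem tsum_rpow_le_of_split {X ι : Type*} [MeasurableSpace X] [MeasurableSpace ι] [Countable ι]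
    [MeasurableSingletonClass ι] {μ : Measure X}
    {F : X → ℝ≥0∞} {W : X → ℝ} {u : ι → ℝ} {p E J : ℝ} (hF : AEMeasurable F μ)
    (hW : Measurable W)
    (hsplit : ∀ s, MeasurableSet s → ∃ b : ι → ℝ≥0∞,
      (∀ n, ENNReal.ofReal |u n| ≤ ∫⁻ x in s, F x ∂μ + b n) ∧
        ∑' n, b n ^ 2 ≤ ∫⁻ x in sᶜ, F x ^ 2 ∂μ)
    (hW0 : ∀ᵐ x ∂μ, 0 < W x) (hp : 1 < p) (hE : 0 < E) (hJ : 0 < J)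
    (hFE : ∫⁻ x, F x ^ 2 * ENNReal.ofReal (W x) ∂μ ≤ ENNReal.ofReal E)
    (hWJ : ∫⁻ x, ENNReal.ofReal (W x ^ (-(p / (p - 1)))) ∂μ ≤ ENNReal.ofReal J) :
    ∑' n, ENNReal.ofReal (|u n| ^ (2 * p)) ≤
      ENNReal.ofReal (4 * p / (p - 1) * (4 * E * J) ^ (p - 1) * E) := by
  have hp1 : 0 < p - 1 := by linarith
  have hΛm : Measurable fun x => √(4 * E * J) * W x ^ (1 / (2 * (p - 1))) :=
    measurable_const.mul (hW.pow_const _)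
  have hΛ0 : ∀ᵐ x ∂μ, 0 ≤ √(4 * E * J) * W x ^ (1 / (2 * (p - 1))) := by
    filter_upwards [hW0] with x hx0
    positivity
  have hcount := fun t (ht : 0 < t) =>
    count_lt_le_of_split hF hW hsplit hW0 hp hE hJ ht hFE hWJ
  set Λ := fun x => √(4 * E * J) * W x ^ (1 / (2 * (p - 1))) with hΛ
  set ν := μ.withDensity fun x => F x ^ 2 with hν
  have hF2 : AEMeasurable (fun x => F x ^ 2) μ := hF.pow_const _
  have hac : ν ≪ μ := withDensity_absolutelyContinuous _ _
  have hlayer := lintegral_rpow_eq_lintegral_meas_le_mul ν (hac hΛ0) hΛm.aemeasurable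
    (p := 2 * p - 2) (by linarith)
  calc ∑' n, ENNReal.ofReal (|u n| ^ (2 * p))
      = ∫⁻ n, ENNReal.ofReal (|u n| ^ (2 * p)) ∂Measure.count := (lintegral_count _).symm
    _ = ENNReal.ofReal (2 * p) * ∫⁻ t in Set.Ioi 0, Measure.count {n | t < |u n|} *
          ENNReal.ofReal (t ^ (2 * p - 1)) :=
        lintegral_rpow_eq_lintegral_meas_lt_mul _ (.of_forall fun n => abs_nonneg _)
          (measurable_of_countable _).aemeasurable (by linarith)
    _ ≤ ENNReal.ofReal (2 * p) * ∫⁻ t in Set.Ioi 0, 4 * (ν {x | t ≤ Λ x} *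
          ENNReal.ofReal (t ^ (2 * p - 2 - 1))) := by
        refine mul_le_mul_right (setLIntegral_mono' measurableSet_Ioi fun t (ht : 0 < t) => ?_) _
        have hm : MeasurableSet {x | t ≤ Λ x} := measurableSet_le measurable_const hΛm
        rw [hν, withDensity_apply _ hm]
        refine (mul_le_mul_left (hcount t ht) _).trans_eq ?_
        rw [mul_right_comm, ← ENNReal.ofReal_mul (by positivity),
          show 4 / t ^ 2 * t ^ (2 * p - 1) = 4 * t ^ (2 * p - 2 - 1) by
            rw [show 2 * p - 1 = 2 * p - 2 - 1 + (2 : ℕ) by push_cast; ring,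
              Real.rpow_add_natCast ht.ne']
            field_simp,
          ENNReal.ofReal_mul (by norm_num), ENNReal.ofReal_ofNat]
        ring
    _ = ENNReal.ofReal (4 * p / (p - 1)) * ∫⁻ x, ENNReal.ofReal (Λ x ^ (2 * p - 2)) ∂ν := by
        rw [hlayer, lintegral_const_mul' _ _ (by norm_num), ← mul_assoc, ← mul_assoc,
          ← ENNReal.ofReal_mul (by positivity), ← ENNReal.ofReal_ofNat (n := 4),
          ← ENNReal.ofReal_mul (by positivity)]
        congr 2
        field_simp
    _ = ENNReal.ofReal (4 * p / (p - 1)) * ∫⁻ x, ENNReal.ofReal ((4 * E * J) ^ (p - 1)) *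
          (F x ^ 2 * ENNReal.ofReal (W x)) ∂μ := by
        rw [hν, lintegral_withDensity_eq_lintegral_mul₀ hF2 (by fun_prop)]
        congr 1
        apply lintegral_congr_ae
        filter_upwards [hW0] with x hx0
        have h1 : Λ x ^ (2 * p - 2) = (4 * E * J) ^ (p - 1) * W x := by
          rw [hΛ]
          simp only
          rw [Real.mul_rpow (by positivity) (by positivity), Real.sqrt_eq_rpow,
            ← Real.rpow_mul (by positivity), ← Real.rpow_mul hx0.le]
          rw [show 1 / 2 * (2 * p - 2) = p - 1 by ring,
            show 1 / (2 * (p - 1)) * (2 * p - 2) = 1 by field_simp, Real.rpow_one]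
        rw [Pi.mul_apply, h1, ENNReal.ofReal_mul (by positivity)]
        ring
    _ ≤ ENNReal.ofReal (4 * p / (p - 1)) * (ENNReal.ofReal ((4 * E * J) ^ (p - 1)) *
          ENNReal.ofReal E) := by
        rw [lintegral_const_mul' _ _ ENNReal.ofReal_ne_top]
        gcongr
    _ = _ := by
        rw [← ENNReal.ofReal_mul (by positivity), ← ENNReal.ofReal_mul (by positivity),
          ← mul_assoc]

theorem integrableOn_sin_half_rpow_neg {a : ℝ} (ha0 : 0 ≤ a) (ha : a < 1) :
    IntegrableOn (fun x => Real.sin (x / 2) ^ (-a)) (Set.Ioo 0 (2 * π)) := by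
  have h1 : IntegrableOn (fun x : ℝ => x ^ (-a)) (Set.Ioo 0 (2 * π)) := by
    rw [← intervalIntegrable_iff_integrableOn_Ioo_of_le (by positivity)]
    exact intervalIntegral.intervalIntegrable_rpow' (by linarith)
  have h2 : IntegrableOn (fun x : ℝ => (2 * π - x) ^ (-a)) (Set.Ioo 0 (2 * π)) := by
    rw [← intervalIntegrable_iff_integrableOn_Ioo_of_le (by positivity)]
    have := (intervalIntegral.intervalIntegrable_rpow' (r := -a) (a := 0) (b := 2 * π)
      (by linarith)).comp_sub_left (2 * π)
    simpa using this.symm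
  have h3 := (h1.add h2).const_mul (π ^ a)
  refine Integrable.mono' h3 (Measurable.aestronglyMeasurable (by fun_prop)) ?_
  filter_upwards [ae_restrict_mem measurableSet_Ioo] with x hx
  obtain ⟨hx0, hx1⟩ := hx
  have hy : 0 < 2 * π - x := by linarith
  have hs : 0 < Real.sin (x / 2) := Real.sin_pos_of_pos_of_lt_pi (by linarith) (by linarith)
  rw [Real.norm_of_nonneg (by positivity)]
  have key : ∀ z : ℝ, 0 < z → z / π ≤ Real.sin (x / 2) →
      Real.sin (x / 2) ^ (-a) ≤ π ^ a * z ^ (-a) := fun z hz h => by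
    refine (Real.rpow_le_rpow_of_nonpos (by positivity) h (by linarith)).trans_eq ?_
    rw [Real.div_rpow hz.le pi_pos.le, Real.rpow_neg pi_pos.le]
    field_simp
  simp only [Pi.add_apply]
  have p1 : 0 ≤ x ^ (-a) := by positivity
  have p2 : 0 ≤ (2 * π - x) ^ (-a) := by positivity
  rcases le_total x π with h | h
  · refine (key x hx0 ?_).trans (by gcongr; linarith)
    have := mul_le_sin (x := x / 2) (by linarith) (by linarith)
    convert this using 1; ring
  · refine (key (2 * π - x) hy ?_).trans (by gcongr; linarith)
    have := mul_le_sin (x := π - x / 2) (by linarith) (by linarith)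
    rw [Real.sin_pi_sub] at this
    convert this using 1; field_simp

theorem integrableOn_one_div_sum_sin_sq_rpow {d : Type*} [Fintype d] [Nonempty d] {q : ℝ}
    (hq0 : 0 ≤ q) (hq : 2 * q < Fintype.card d) :
    IntegrableOn (fun x : d → ℝ => 1 / (∑ j, Real.sin (x j / 2) ^ 2) ^ q)
      (Set.univ.pi fun _ => Set.Ioo 0 (2 * π)) := by
  have hd : (0 : ℝ) < Fintype.card d := by exact_mod_cast Fintype.card_pos
  have h1 : IntegrableOn (fun x : d → ℝ => ∏ j, Real.sin (x j / 2) ^ (-(2 * q / Fintype.card d)))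
      (Set.univ.pi fun _ => Set.Ioo 0 (2 * π)) := by
    rw [IntegrableOn, volume_pi, Measure.restrict_pi_pi]
    exact Integrable.fintype_prod (f := fun _ x => Real.sin (x / 2) ^ (-(2 * q / Fintype.card d)))
      fun _ => integrableOn_sin_half_rpow_neg (by positivity) ((div_lt_one hd).2 hq)
  refine Integrable.mono' h1 (Measurable.aestronglyMeasurable (by fun_prop)) ?_
  filter_upwards [ae_restrict_mem (MeasurableSet.univ_pi fun _ => measurableSet_Ioo)] with x hx
  have hs : ∀ j, 0 < Real.sin (x j / 2) := fun j => by
    have := hx j trivial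
    exact Real.sin_pos_of_pos_of_lt_pi (by linarith [this.1]) (by linarith [this.2])
  have hS : 0 < ∑ j, Real.sin (x j / 2) ^ 2 :=
    Finset.sum_pos (fun j _ => pow_pos (hs j) 2) Finset.univ_nonempty
  rw [Real.norm_of_nonneg (by positivity), one_div, ← Real.rpow_neg hS.le]
  calc (∑ j, Real.sin (x j / 2) ^ 2) ^ (-q)
      = ∏ _j : d, (∑ j, Real.sin (x j / 2) ^ 2) ^ (-(q / Fintype.card d)) := by
        rw [Finset.prod_const, Finset.card_univ, ← Real.rpow_mul_natCast hS.le]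
        congr 1
        field_simp
    _ ≤ ∏ j, Real.sin (x j / 2) ^ (-(2 * q / Fintype.card d)) := by
        refine Finset.prod_le_prod (fun j _ => by positivity) fun j _ => ?_
        have h2 : Real.sin (x j / 2) ^ (-(2 * q / Fintype.card d)) =
            (Real.sin (x j / 2) ^ 2) ^ (-(q / Fintype.card d)) := by
          rw [← Real.rpow_natCast, ← Real.rpow_mul (hs j).le]
          congr 1
          push_cast
          ring
        rw [h2]
        refine Real.rpow_le_rpow_of_nonpos (pow_pos (hs j) 2) ?_ (by
          have : 0 ≤ q / Fintype.card d := by positivity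
          linarith)
        exact Finset.single_le_sum (f := fun j => Real.sin (x j / 2) ^ 2)
          (fun i _ => sq_nonneg _) (Finset.mem_univ j)

section FourierTorus

/-- The measure on `ℝ / ℤ` is normalised to have total volume 1, as for `mFourierCoeff`. -/
noncomputable local instance unitAddCircleMeasureSpace : MeasureSpace UnitAddCircle :=
  ⟨AddCircle.haarAddCircle⟩

local instance : IsProbabilityMeasure (volume : Measure UnitAddCircle) :=
  inferInstanceAs (IsProbabilityMeasure AddCircle.haarAddCircle)

open UnitAddTorus

variable {d : Type*} [Fintype d]

theorem norm_mFourier_apply (n : d → ℤ) (x : UnitAddTorus d) : ‖mFourier n x‖ = 1 := by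
  simp only [mFourier, ContinuousMap.coe_mk, norm_prod, fourier_apply, Circle.norm_coe,
    Finset.prod_const_one]

theorem tsum_enorm_mFourierCoeff_sq {f : UnitAddTorus d → ℂ} (hf : MemLp f 2 volume) :
    ∑' n, ‖mFourierCoeff f n‖ₑ ^ 2 = ∫⁻ x, ‖f x‖ₑ ^ 2 := by
  have hcoeff : ∀ n, mFourierCoeff (hf.toLp f) n = mFourierCoeff f n := fun n =>
    integral_congr_ae (hf.coeFn_toLp.mono fun x hx => by simp only [hx])
  have h := hasSum_sq_mFourierCoeff (hf.toLp f)
  simp only [hcoeff] at h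
  have hfint : ∫ x, ‖hf.toLp f x‖ ^ 2 = ∫ x, ‖f x‖ ^ 2 :=
    integral_congr_ae (hf.coeFn_toLp.mono fun x hx => by simp only [hx])
  rw [hfint] at h
  have h2 : ∀ z : ℂ, ‖z‖ₑ ^ 2 = ENNReal.ofReal (‖z‖ ^ 2) := fun z => by
    rw [ENNReal.ofReal_pow (norm_nonneg _), ofReal_norm]
  simp only [h2]
  rw [← ENNReal.ofReal_tsum_of_nonneg (fun n => by positivity) h.summable, h.tsum_eq,
    ofReal_integral_eq_lintegral_ofReal (hf.integrable_norm_pow two_ne_zero)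
      (.of_forall fun x => by positivity)]

theorem exists_memLp_mFourierCoeff_eq {u : (d → ℤ) → ℝ} (hu : Summable fun n => u n ^ 2) :
    ∃ f : UnitAddTorus d → ℂ, MemLp f 2 volume ∧ ∀ n, mFourierCoeff f n = u n := by
  have hmem : Memℓp (fun n => (u n : ℂ)) 2 := by
    rw [memℓp_gen_iff (by norm_num)]
    simpa using hu
  refine ⟨mFourierBasis.repr.symm ⟨_, hmem⟩, Lp.memLp _, fun n => ?_⟩
  rw [← mFourierBasis_repr]
  simp

theorem exists_split_mFourierCoeff {f : UnitAddTorus d → ℂ} (hf : MemLp f 2 volume)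
    {s : Set (UnitAddTorus d)} (hs : MeasurableSet s) :
    ∃ b : (d → ℤ) → ℝ≥0∞, (∀ n, ‖mFourierCoeff f n‖ₑ ≤ (∫⁻ x in s, ‖f x‖ₑ) + b n) ∧
      ∑' n, b n ^ 2 ≤ ∫⁻ x in sᶜ, ‖f x‖ₑ ^ 2 := by
  refine ⟨fun n => ‖mFourierCoeff (sᶜ.indicator f) n‖ₑ, fun n => ?_, ?_⟩
  · have hfint : Integrable (fun x => mFourier (-n) x • f x) volume :=
      (hf.integrable one_le_two).bdd_mul (c := 1)
        (mFourier (-n)).continuous.aestronglyMeasurable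
        (.of_forall fun x => (norm_mFourier_apply _ x).le)
    have h1 : mFourierCoeff f n = (∫ x in s, mFourier (-n) x • f x) +
        mFourierCoeff (sᶜ.indicator f) n := by
      have h2 : mFourierCoeff (sᶜ.indicator f) n = ∫ x in sᶜ, mFourier (-n) x • f x := by
        rw [mFourierCoeff, ← integral_indicator hs.compl]
        congr 1 with x
        by_cases hx : x ∈ sᶜ <;> simp [Set.indicator, hx]
      rw [h2]
      exact (integral_add_compl hs hfint).symm
    rw [h1]
    refine (enorm_add_le _ _).trans ?_
    gcongr
    refine (enorm_integral_le_lintegral_enorm _).trans_eq (lintegral_congr fun x => ?_)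
    rw [smul_eq_mul, enorm_mul, ← ofReal_norm, norm_mFourier_apply]
    simp
  · rw [tsum_enorm_mFourierCoeff_sq (hf.indicator hs.compl), ← lintegral_indicator hs.compl]
    refine le_of_eq (lintegral_congr fun x => ?_)
    by_cases hx : x ∈ sᶜ <;> simp [Set.indicator, hx]

theorem tsum_mFourierCoeff_add_sub_sq {f : UnitAddTorus d → ℂ} (hf : MemLp f 2 volume)
    (m : d → ℤ) :
    ∑' n, ‖mFourierCoeff f (n + m) - mFourierCoeff f n‖ₑ ^ 2 =
      ∫⁻ x, ‖f x‖ₑ ^ 2 * ENNReal.ofReal (‖mFourier (-m) x - 1‖ ^ 2) := by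
  have hg : MemLp (fun x => (mFourier (-m) x - 1) * f x) 2 volume :=
    hf.of_le_mul (c := 2)
      (((mFourier (-m)).continuous.sub continuous_const).aestronglyMeasurable.mul
        hf.aestronglyMeasurable)
      (.of_forall fun x => by
        rw [norm_mul]
        gcongr
        exact (norm_sub_le _ _).trans (by rw [norm_mFourier_apply]; norm_num))
  have hfint : ∀ n, Integrable (fun x => mFourier n x • f x) volume := fun n =>
    (hf.integrable one_le_two).bdd_mul (c := 1) (mFourier n).continuous.aestronglyMeasurable
      (.of_forall fun x => (norm_mFourier_apply _ x).le)
  have hcoeff : ∀ n, mFourierCoeff (fun x => (mFourier (-m) x - 1) * f x) n =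
      mFourierCoeff f (n + m) - mFourierCoeff f n := fun n => by
    rw [mFourierCoeff, mFourierCoeff, mFourierCoeff, ← integral_sub (hfint _) (hfint _)]
    congr 1 with x
    rw [neg_add, mFourier_add]
    simp only [smul_eq_mul]
    ring
  simp only [← hcoeff]
  rw [tsum_enorm_mFourierCoeff_sq hg]
  refine lintegral_congr fun x => ?_
  rw [enorm_mul, mul_pow, mul_comm, ENNReal.ofReal_pow (norm_nonneg _), ofReal_norm]

theorem norm_mFourier_neg_single_sub_one_sq [DecidableEq d] (y : d → ℝ) (j : d) :
    ‖mFourier (-Pi.single j 1) (fun i => (y i : UnitAddCircle)) - 1‖ ^ 2 =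
      4 * Real.sin (2 * π * y j / 2) ^ 2 := by
  rw [mFourier_neg, mFourier_single, fourier_coe_apply, ← RCLike.norm_conj, map_sub,
    RCLike.conj_conj, map_one]
  rw [show 2 * (π : ℂ) * Complex.I * (1 : ℤ) * y j / (1 : ℝ) = Complex.I * (2 * π * y j : ℝ) by
    push_cast; ring, Complex.norm_exp_I_mul_ofReal_sub_one]
  simp [mul_pow]
  norm_num

theorem lintegral_unitAddTorus_eq {G : UnitAddTorus d → ℝ≥0∞} (hG : Measurable G) :
    ∫⁻ x, G x = ENNReal.ofReal (((2 * π) ^ Fintype.card d)⁻¹) *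
      ∫⁻ x in Set.univ.pi fun _ : d => Set.Ioo (0 : ℝ) (2 * π),
        G (fun i => ((x i / (2 * π) : ℝ) : UnitAddCircle)) := by
  have hpi : 0 < 2 * π := by positivity
  have hmap := Measure.map_addHaar_smul (volume : Measure (d → ℝ)) hpi.ne'
  have hIoc : MeasurableSet (Set.univ.pi fun _ : d => Set.Ioc (0 : ℝ) (2 * π)) :=
    MeasurableSet.univ_pi fun _ => measurableSet_Ioc
  have hmeas : Measurable fun x : d → ℝ => G (fun i => ((x i / (2 * π) : ℝ) : UnitAddCircle)) :=
    hG.comp (measurable_pi_lambda _ fun i =>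
      AddCircle.measurable_mk'.comp ((measurable_pi_apply i).div_const _))
  have h := setLIntegral_map hIoc hmeas (measurable_const_smul (2 * π))
    (μ := (volume : Measure (d → ℝ)))
  rw [hmap, Measure.restrict_smul, lintegral_smul_measure, smul_eq_mul,
    Module.finrank_fintype_fun_eq_card, abs_of_pos (by positivity)] at h
  have hae : (Set.univ.pi fun _ : d => Set.Ioo (0 : ℝ) (2 * π)) =ᵐ[volume]
      Set.univ.pi fun _ : d => Set.Ioc (0 : ℝ) (2 * π) :=
    Measure.univ_pi_Ioo_ae_eq_Icc.trans Measure.univ_pi_Ioc_ae_eq_Icc.symm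
  rw [setLIntegral_congr hae, h, lintegral_preimage G 0]
  have hset : {x : d → ℝ | ∀ i, x i ∈ Set.Ioc ((0 : d → ℝ) i) ((0 : d → ℝ) i + 1)} =
      (fun x => (2 * π) • x) ⁻¹' (Set.univ.pi fun _ : d => Set.Ioc (0 : ℝ) (2 * π)) := by
    ext x
    simp [hpi]
  rw [hset]
  refine lintegral_congr fun x => ?_
  simp [hpi.ne']

theorem sum_norm_mFourier_neg_single_sub_one_sq [DecidableEq d] (x : d → ℝ) :
    ∑ j, ‖mFourier (-Pi.single j 1) (fun i => ((x i / (2 * π) : ℝ) : UnitAddCircle)) - 1‖ ^ 2 =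
      4 * ∑ j, Real.sin (x j / 2) ^ 2 := by
  rw [Finset.mul_sum]
  refine Finset.sum_congr rfl fun j _ => ?_
  rw [norm_mFourier_neg_single_sub_one_sq (fun i => x i / (2 * π)), mul_div_cancel₀]
  positivity

theorem sum_sin_sq_pos [Nonempty d] {x : d → ℝ}
    (hx : x ∈ Set.univ.pi fun _ : d => Set.Ioo (0 : ℝ) (2 * π)) :
    0 < ∑ j, Real.sin (x j / 2) ^ 2 := by
  refine Finset.sum_pos (fun j _ => pow_pos ?_ 2) Finset.univ_nonempty
  have := hx j trivial
  exact Real.sin_pos_of_pos_of_lt_pi (by linarith [this.1]) (by linarith [this.2])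

theorem measurable_sum_norm_mFourier_sub_one_sq [DecidableEq d] :
    Measurable fun x : UnitAddTorus d => ∑ j, ‖mFourier (-Pi.single j 1) x - 1‖ ^ 2 :=
  (continuous_finsetSum _ fun j _ =>
    ((mFourier (-Pi.single j 1)).continuous.sub continuous_const).norm.pow 2).measurable

theorem ae_sum_norm_mFourier_sub_one_sq_pos [DecidableEq d] [Nonempty d] :
    ∀ᵐ x : UnitAddTorus d, 0 < ∑ j, ‖mFourier (-Pi.single j 1) x - 1‖ ^ 2 := by
  have hm : MeasurableSet
      {x : UnitAddTorus d | 0 < ∑ j, ‖mFourier (-Pi.single j 1) x - 1‖ ^ 2} :=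
    measurableSet_lt measurable_const measurable_sum_norm_mFourier_sub_one_sq
  rw [ae_iff, ← Set.compl_ofPred, ← lintegral_indicator_one hm.compl,
    lintegral_unitAddTorus_eq (measurable_one.indicator hm.compl)]
  rw [setLIntegral_congr_fun (g := fun _ => 0)
    (MeasurableSet.univ_pi fun _ => measurableSet_Ioo), lintegral_zero, mul_zero]
  intro x hx
  have := sum_sin_sq_pos hx
  simp only
  rw [Set.indicator_of_notMem]
  simp only [Set.mem_compl_iff, Set.mem_ofPred_eq, not_not,
    sum_norm_mFourier_neg_single_sub_one_sq]
  positivity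

theorem lintegral_sum_norm_mFourier_sub_one_sq_rpow [DecidableEq d] [Nonempty d] {q : ℝ}
    (hq0 : 0 ≤ q) (hq : 2 * q < Fintype.card d) :
    ∫⁻ x : UnitAddTorus d,
        ENNReal.ofReal ((∑ j, ‖mFourier (-Pi.single j 1) x - 1‖ ^ 2) ^ (-q)) =
      ENNReal.ofReal (((2 * π) ^ Fintype.card d)⁻¹ * 4 ^ (-q) *
        ∫ x in Set.univ.pi fun _ : d => Set.Icc (0 : ℝ) (2 * π),
          1 / (∑ j, Real.sin (x j / 2) ^ 2) ^ q) := by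
  rw [lintegral_unitAddTorus_eq
    (measurable_sum_norm_mFourier_sub_one_sq.pow_const _).ennreal_ofReal]
  rw [mul_assoc, ENNReal.ofReal_mul (by positivity)]
  congr 1
  have hae : (Set.univ.pi fun _ : d => Set.Ioo (0 : ℝ) (2 * π)) =ᵐ[volume]
      Set.univ.pi fun _ : d => Set.Icc (0 : ℝ) (2 * π) := by
    rw [Set.pi_univ_Icc]
    exact Measure.univ_pi_Ioo_ae_eq_Icc
  rw [← setIntegral_congr_set hae, ← integral_const_mul,
    ofReal_integral_eq_lintegral_ofReal
      ((integrableOn_one_div_sum_sin_sq_rpow hq0 hq).const_mul _)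
      (.of_forall fun x => by positivity)]
  refine lintegral_congr fun x => ?_
  have : 0 ≤ ∑ j, Real.sin (x j / 2) ^ 2 := by positivity
  rw [sum_norm_mFourier_neg_single_sub_one_sq, Real.mul_rpow (by norm_num) this,
    Real.rpow_neg this, one_div]

theorem summable_sum_sub_sq [DecidableEq d] {u : (d → ℤ) → ℝ} (hu : Summable fun n => u n ^ 2) :
    Summable fun n => ∑ j, (u (n + Pi.single j 1) - u n) ^ 2 := by
  refine summable_sum (f := fun j n => (u (n + Pi.single j 1) - u n) ^ 2) fun j _ => ?_
  have h1 : Summable fun n => u (n + Pi.single j 1) ^ 2 :=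
    hu.comp_injective (add_left_injective (Pi.single j 1 : d → ℤ))
  refine .of_nonneg_of_le (fun n => sq_nonneg _) (fun n => ?_) ((h1.add hu).mul_left 2)
  nlinarith [sq_nonneg (u (n + Pi.single j 1) + u n)]

theorem lintegral_enorm_sq_mul_sum_norm_mFourier_sub_one_sq [DecidableEq d]
    {f : UnitAddTorus d → ℂ} (hf : MemLp f 2 volume) {u : (d → ℤ) → ℝ}
    (hu : Summable fun n => u n ^ 2) (hfu : ∀ n, mFourierCoeff f n = u n) :
    ∫⁻ x, ‖f x‖ₑ ^ 2 * ENNReal.ofReal (∑ j, ‖mFourier (-Pi.single j 1) x - 1‖ ^ 2) =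
      ENNReal.ofReal (∑' n, ∑ j, (u (n + Pi.single j 1) - u n) ^ 2) := by
  rw [ENNReal.ofReal_tsum_of_nonneg (fun n => by positivity) (summable_sum_sub_sq hu)]
  simp only [ENNReal.ofReal_sum_of_nonneg (fun _ _ => sq_nonneg _), Finset.mul_sum]
  rw [lintegral_finsetSum', Summable.tsum_finsetSum fun _ _ => ENNReal.summable]
  · refine Finset.sum_congr rfl fun j _ => ?_
    rw [← tsum_mFourierCoeff_add_sub_sq hf]
    refine tsum_congr fun n => ?_
    rw [hfu, hfu, ← Complex.ofReal_sub, ← ofReal_norm, Complex.norm_real,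
      ← ENNReal.ofReal_pow (norm_nonneg _), Real.norm_eq_abs, sq_abs]
  · intro j _
    exact (hf.aestronglyMeasurable.enorm.pow_const _).mul
      ((((mFourier (-Pi.single j 1)).continuous.sub continuous_const).norm.pow
        2).measurable.ennreal_ofReal.aemeasurable)

theorem tsum_rpow_le_of_gradient_lt [DecidableEq d] [Nonempty d] {p : ℝ} (hp : 1 < p)
    (hpd : 2 * (p / (p - 1)) < Fintype.card d) {u : (d → ℤ) → ℝ}
    (hu : Summable fun n => u n ^ 2) {E J : ℝ} (hE0 : 0 < E) (hJ0 : 0 < J)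
    (hE : ∑' n, ∑ j, (u (n + Pi.single j 1) - u n) ^ 2 ≤ E)
    (hJ : ((2 * π) ^ Fintype.card d)⁻¹ * 4 ^ (-(p / (p - 1))) *
        ∫ x in Set.univ.pi fun _ : d => Set.Icc (0 : ℝ) (2 * π),
          1 / (∑ j, Real.sin (x j / 2) ^ 2) ^ (p / (p - 1)) ≤ J) :
    ∑' n, |u n| ^ (2 * p) ≤ 4 * p / (p - 1) * (4 * E * J) ^ (p - 1) * E := by
  have hp1 : 0 < p - 1 := by linarith
  obtain ⟨f, hf, hfu⟩ := exists_memLp_mFourierCoeff_eq hu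
  have h := tsum_rpow_le_of_split (u := u) (p := p) (E := E) (J := J) hf.aestronglyMeasurable.enorm
    measurable_sum_norm_mFourier_sub_one_sq (fun s hs => by
      obtain ⟨b, hb, hb2⟩ := exists_split_mFourierCoeff hf hs
      refine ⟨b, fun n => ?_, hb2⟩
      convert hb n using 1
      rw [hfu, ← ofReal_norm, Complex.norm_real, Real.norm_eq_abs])
    ae_sum_norm_mFourier_sub_one_sq_pos hp hE0 hJ0
    ((lintegral_enorm_sq_mul_sum_norm_mFourier_sub_one_sq hf hu hfu).trans_le
      (ENNReal.ofReal_le_ofReal hE))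
    ((lintegral_sum_norm_mFourier_sub_one_sq_rpow (by positivity) hpd).trans_le
      (ENNReal.ofReal_le_ofReal hJ))
  refine tsum_le_of_sum_le' (by positivity) fun s => ?_
  rw [← ENNReal.ofReal_le_ofReal_iff (by positivity),
    ENNReal.ofReal_sum_of_nonneg fun _ _ => by positivity]
  exact (ENNReal.sum_le_tsum s).trans h

end FourierTorus

theorem rpow_le_of_le_mul_rpow {p T E J : ℝ} (hp : 1 < p) (hT : 0 ≤ T) (hE : 0 < E) (hJ : 0 < J)
    (h : T ≤ 4 * p / (p - 1) * (4 * E * J) ^ (p - 1) * E) :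
    T ^ (1 / p) ≤ 4 * (p / (p - 1)) * E * J ^ ((p - 1) / p) := by
  have hp1 : 0 < p - 1 := by linarith
  have hp0 : 0 < p := by linarith
  have h1 : 4 * p / (p - 1) * (4 * E * J) ^ (p - 1) * E =
      p / (p - 1) * (4 * E) ^ p * J ^ (p - 1) := by
    rw [Real.mul_rpow (by positivity) hJ.le, Real.rpow_sub_one (by positivity) p]
    field_simp
  rw [h1] at h
  calc T ^ (1 / p) ≤ (p / (p - 1) * (4 * E) ^ p * J ^ (p - 1)) ^ (1 / p) := by gcongr
    _ = (p / (p - 1)) ^ (1 / p) * (4 * E) * J ^ ((p - 1) / p) := by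
        rw [Real.mul_rpow (by positivity) (by positivity),
          Real.mul_rpow (by positivity) (by positivity), ← Real.rpow_mul (by positivity),
          ← Real.rpow_mul hJ.le, mul_one_div_cancel hp0.ne', Real.rpow_one, mul_one_div]
    _ ≤ (p / (p - 1)) ^ (1 : ℝ) * (4 * E) * J ^ ((p - 1) / p) := by
        gcongr
        · rw [le_div_iff₀ hp1]; linarith
        · rw [div_le_one hp0]; exact hp.le
    _ = _ := by rw [Real.rpow_one]; ring

/-- Discrete Sobolev-type inequality in the non-limiting case: for `d ≥ 3`,
`p > d/(d-2)`, `p' = p/(p-1)` and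
`I_{p',d} = (∫_{[0,2π]^d} dx/(sin²(x₁/2)+⋯+sin²(x_d/2))^{p'})^{1/p'}`,
every `u ∈ l²(ℤ^d)` satisfies
`(∑ |u(n)|^{2p})^{1/p} ≤ (1/4)(2π)^{d(p+1)/p} I_{p',d} ‖∇u‖²`. -/
theorem discrete_sobolev (d : ℕ) (hd : 3 ≤ d) (p : ℝ) (hp : (d : ℝ) / (d - 2) < p)
    (u : (Fin d → ℤ) → ℝ) (hu : Summable fun n => u n ^ 2) :
    (∑' n : Fin d → ℤ, |u n| ^ (2 * p)) ^ (1 / p) ≤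
      (1 / 4) * (2 * π) ^ ((d : ℝ) * (p + 1) / p) *
        ((∫ x in Set.univ.pi fun _ : Fin d => Set.Icc (0 : ℝ) (2 * π),
            1 / (∑ j, Real.sin (x j / 2) ^ 2) ^ (p / (p - 1))) ^ ((p - 1) / p)) *
        (∑' n : Fin d → ℤ, ∑ j, (u (n + Pi.single j 1) - u n) ^ 2) := by
  have hd3 : (3 : ℝ) ≤ d := by exact_mod_cast hd
  have hd2 : (0 : ℝ) < d - 2 := by linarith
  have hdp : (d : ℝ) < p * (d - 2) := (div_lt_iff₀ hd2).1 hp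
  have hp1 : 1 < p := lt_trans ((one_lt_div hd2).2 (by linarith)) hp
  have hp1' : 0 < p - 1 := by linarith
  have hq : 2 * (p / (p - 1)) < d := by
    rw [← mul_div_assoc, div_lt_iff₀ hp1']
    linarith
  have : Nonempty (Fin d) := ⟨⟨0, by lia⟩⟩
  set E := ∑' n : Fin d → ℤ, ∑ j, (u (n + Pi.single j 1) - u n) ^ 2
  set I := ∫ x in Set.univ.pi fun _ : Fin d => Set.Icc (0 : ℝ) (2 * π),
    1 / (∑ j, Real.sin (x j / 2) ^ 2) ^ (p / (p - 1))
  set T := ∑' n : Fin d → ℤ, |u n| ^ (2 * p)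
  have hE : 0 ≤ E := tsum_nonneg fun n => by positivity
  have hI : 0 ≤ I := integral_nonneg fun x => by positivity
  have hT : 0 ≤ T := tsum_nonneg fun n => by positivity
  set J := ((2 * π) ^ d)⁻¹ * 4 ^ (-(p / (p - 1))) * I with hJdef
  have hJ : 0 ≤ J := by positivity
  have hε : ∀ ε : ℝ, 0 < ε →
      T ^ (1 / p) ≤ 4 * (p / (p - 1)) * (E + ε) * (J + ε) ^ ((p - 1) / p) := fun ε hε =>
    rpow_le_of_le_mul_rpow hp1 hT (by positivity) (by positivity)
      (tsum_rpow_le_of_gradient_lt hp1 (by simpa using hq) hu (by positivity) (by positivity)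
        (by linarith) (by rw [Fintype.card_fin]; linarith))
  have hcont : Continuous fun ε : ℝ =>
      4 * (p / (p - 1)) * (E + ε) * (J + ε) ^ ((p - 1) / p) := by
    have : Continuous fun x : ℝ => x ^ ((p - 1) / p) :=
      Real.continuous_rpow_const (by positivity)
    fun_prop
  have hmain : T ^ (1 / p) ≤ 4 * (p / (p - 1)) * E * J ^ ((p - 1) / p) := by
    have hlim := (hcont.tendsto 0).mono_left (nhdsWithin_le_nhds (s := Set.Ioi 0))
    simp only [add_zero] at hlim
    exact ge_of_tendsto hlim (Filter.eventually_of_mem self_mem_nhdsWithin hε)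
  have hJrpow : J ^ ((p - 1) / p) =
      (2 * π) ^ (-(d * (p - 1) / p)) * (1 / 4) * I ^ ((p - 1) / p) := by
    rw [hJdef, Real.mul_rpow (by positivity) hI, Real.mul_rpow (by positivity) (by positivity),
      ← Real.rpow_natCast, ← Real.rpow_neg (by positivity), ← Real.rpow_mul (by positivity),
      ← Real.rpow_mul (by norm_num)]
    rw [show -(p / (p - 1)) * ((p - 1) / p) = -1 by field_simp, Real.rpow_neg_one]
    congr 3
    · ring
    · norm_num
  have hconst : 4 * (p / (p - 1)) * (2 * π) ^ (-(d * (p - 1) / p)) ≤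
      (2 * π) ^ ((d : ℝ) * (p + 1) / p) := by
    have h2 : (2 * π) ^ ((d : ℝ) * (p + 1) / p) =
        (2 * π) ^ (2 * d) * (2 * π) ^ (-(d * (p - 1) / p)) := by
      rw [← Real.rpow_natCast, ← Real.rpow_add (by positivity)]
      congr 1
      push_cast
      field_simp
      ring
    rw [h2]
    gcongr
    calc 4 * (p / (p - 1)) ≤ ((2 * d : ℕ) : ℝ) := by push_cast; linarith
      _ ≤ 2 ^ (2 * d) := by exact_mod_cast Nat.lt_two_pow_self.le
      _ ≤ (2 * π) ^ (2 * d) := by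
        gcongr
        linarith [pi_gt_three]
  calc T ^ (1 / p) ≤ 4 * (p / (p - 1)) * E * J ^ ((p - 1) / p) := hmain
    _ = 4 * (p / (p - 1)) * (2 * π) ^ (-(d * (p - 1) / p)) *
          (1 / 4 * I ^ ((p - 1) / p) * E) := by rw [hJrpow]; ring
    _ ≤ (2 * π) ^ ((d : ℝ) * (p + 1) / p) * (1 / 4 * I ^ ((p - 1) / p) * E) := by gcongr
    _ = _ := by ring
end
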